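/- arXiv:1803.10716 — 5 statements merged into one kernel-verified Lean document; each statement's English description precedes it below -/
import Mathlib

section
/- Let r, p, α, β be positive integers, and let φ, ψ be functions of one complex variable analytic at 0 with φ(0) ≠ 0 and ψ(0) ≠ 0. Set f(t) = t^α·φ(t) and g(u) = u^β·ψ(u), and assume f(u^r) = g(u)^p for all u in some neighborhood of 0 in ℂ. Let m be a positive integer dividing p. Then the function u ↦ g(u)^{p/m − 1}·g′(u) has order of vanishing at 0 exactly β·p/m − 1 (which equals α·r/m − 1); consequently, there exists a function h analytic at 0 with g(u)^{p/m − 1}·g′(u) = u^{r−1}·h(u) near 0 if and only if α ≥ m. -/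
open Filter Topology

/-- A function of the form `u ^ n * c u` near `0`, with `c` analytic and `c 0 ≠ 0`, has analytic
order `n` at `0`. -/
lemma analyticOrderAt_eq_of_eventually_eq_pow_mul {F c : ℂ → ℂ} {n : ℕ}
    (hc : AnalyticAt ℂ c 0) (hc0 : c 0 ≠ 0) (hF : ∀ᶠ u in 𝓝 (0 : ℂ), F u = u ^ n * c u) :
    analyticOrderAt F 0 = n := by
  have hFa : AnalyticAt ℂ F 0 :=
    ((analyticAt_id.pow n).mul hc).congr (hF.mono fun u hu => by simp [hu])
  exact hFa.analyticOrderAt_eq_natCast.2 ⟨c, hc, hc0, hF.mono fun u hu => by simp [hu]⟩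

/-- Near `0`, the derivative of `u ^ n * ψ u` is `u ^ (n - 1) * (n * ψ u + u * ψ' u)`. -/
lemma eventually_deriv_pow_mul_eq {ψ : ℂ → ℂ} {n : ℕ} (hn : 0 < n) (hψ : AnalyticAt ℂ ψ 0) :
    ∀ᶠ u in 𝓝 (0 : ℂ),
      deriv (fun v => v ^ n * ψ v) u = u ^ (n - 1) * (n * ψ u + u * deriv ψ u) := by
  filter_upwards [hψ.eventually_analyticAt] with u hu
  rw [((hasDerivAt_pow n u).fun_mul hu.differentiableAt.hasDerivAt).deriv]
  obtain ⟨b, rfl⟩ := Nat.exists_eq_add_of_lt hn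
  simp only [zero_add, Nat.add_sub_cancel]
  ring

/-- Local model of a curve germ lifted through an adapted covering, with orbifold
multiplicity `m ∣ p`: the pullback `g^{p/m - 1}·g'` of the local orbifold 1-form
`w^{-p(1-1/m)} π^*(dz)` has order of vanishing at `0` exactly `β·(p/m) - 1 = α·r/m - 1`,
and it is divisible by `u^{r-1}` (with analytic quotient) iff `α ≥ m`,
i.e. iff `f` is an orbifold curve germ. -/
theorem orbifold_form_pullback_order
    (r p α β : ℕ) (hr : 0 < r) (hp : 0 < p) (hα : 0 < α) (hβ : 0 < β)
    (φ ψ : ℂ → ℂ) (hφ : AnalyticAt ℂ φ 0) (hψ : AnalyticAt ℂ ψ 0)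
    (hφ0 : φ 0 ≠ 0) (hψ0 : ψ 0 ≠ 0)
    (f g : ℂ → ℂ)
    (hf : ∀ t : ℂ, f t = t ^ α * φ t)
    (hg : ∀ u : ℂ, g u = u ^ β * ψ u)
    (hfg : ∀ᶠ u in 𝓝 (0 : ℂ), f (u ^ r) = g u ^ p)
    (m : ℕ) (hm : 0 < m) (hmp : m ∣ p) :
    (∃ c : ℂ → ℂ, AnalyticAt ℂ c 0 ∧ c 0 ≠ 0 ∧
        ∀ᶠ u in 𝓝 (0 : ℂ),
          g u ^ (p / m - 1) * deriv g u = u ^ (β * (p / m) - 1) * c u) ∧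
    β * (p / m) - 1 = α * r / m - 1 ∧
    ((∃ h : ℂ → ℂ, AnalyticAt ℂ h 0 ∧
        ∀ᶠ u in 𝓝 (0 : ℂ),
          g u ^ (p / m - 1) * deriv g u = u ^ (r - 1) * h u) ↔ m ≤ α) := by
  obtain ⟨k, rfl⟩ := hmp
  have hk : 0 < k := Nat.pos_of_mul_pos_left hp
  rw [Nat.mul_div_cancel_left k hm]
  have hαr : α * r = β * (m * k) := by
    have hleft : analyticOrderAt (fun u => f (u ^ r)) 0 = (α * r : ℕ) := by
      have h0 : (0 : ℂ) ^ r = 0 := zero_pow hr.ne'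
      refine analyticOrderAt_eq_of_eventually_eq_pow_mul (c := fun u => φ (u ^ r))
        (AnalyticAt.fun_comp (by rwa [h0]) (analyticAt_id.pow r)) (by rwa [h0])
        (Eventually.of_forall fun u => ?_)
      simp only [hf]
      ring
    have hright : analyticOrderAt (fun u => g u ^ (m * k)) 0 = (β * (m * k) : ℕ) := by
      refine analyticOrderAt_eq_of_eventually_eq_pow_mul (c := fun u => ψ u ^ (m * k))
        (hψ.pow _) (pow_ne_zero _ hψ0) (Eventually.of_forall fun u => ?_)
      simp only [hg, mul_pow, ← pow_mul]
    have heq := analyticOrderAt_congr hfg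
    rw [hleft, hright] at heq
    exact_mod_cast heq
  have hαrm : α * r / m = β * k := by
    rw [hαr, mul_left_comm, Nat.mul_div_cancel_left _ hm]
  have hle : r ≤ β * k ↔ m ≤ α := by
    rw [← Nat.mul_le_mul_left_iff hm, ← mul_left_comm, ← hαr, Nat.mul_le_mul_right_iff hr]
  have hβk : 0 < β * k := Nat.mul_pos hβ hk
  let c : ℂ → ℂ := fun u => ψ u ^ (k - 1) * (β * ψ u + u * deriv ψ u)
  have hc : AnalyticAt ℂ c 0 :=
    (hψ.pow _).mul ((analyticAt_const.mul hψ).add (analyticAt_id.mul hψ.deriv))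
  have hc0 : c 0 ≠ 0 := by simp [c, hψ0, hβ.ne']
  have hgc : ∀ᶠ u in 𝓝 (0 : ℂ), g u ^ (k - 1) * deriv g u = u ^ (β * k - 1) * c u := by
    obtain rfl : g = fun v => v ^ β * ψ v := funext hg
    filter_upwards [eventually_deriv_pow_mul_eq hβ hψ] with u hu
    have hexp : β * k - 1 = β * (k - 1) + (β - 1) := by
      obtain ⟨j, rfl⟩ := Nat.exists_eq_add_of_lt hk
      simp only [zero_add, Nat.add_sub_cancel, mul_add, mul_one]
      omega
    rw [hu, hexp, pow_add, pow_mul]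
    simp only [c]
    ring
  refine ⟨⟨c, hc, hc0, hgc⟩, by rw [hαrm], ?_⟩
  rw [← hle]
  constructor
  · rintro ⟨h, hh, hgh⟩
    have hle' : ((r - 1 : ℕ) : ℕ∞) ≤ analyticOrderAt (fun u => g u ^ (k - 1) * deriv g u) 0 := by
      have hFa : AnalyticAt ℂ (fun u => g u ^ (k - 1) * deriv g u) 0 :=
        ((analyticAt_id.pow (r - 1)).mul hh).congr (hgh.mono fun u hu => by simp [hu])
      exact (natCast_le_analyticOrderAt hFa).2 ⟨h, hh, hgh.mono fun u hu => by simp [hu]⟩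
    rw [analyticOrderAt_eq_of_eventually_eq_pow_mul hc hc0 hgc, Nat.cast_le] at hle'
    omega
  · intro hrk
    refine ⟨fun u => u ^ (β * k - r) * c u, (analyticAt_id.pow _).mul hc, ?_⟩
    filter_upwards [hgc] with u hu
    rw [hu, show β * k - 1 = (r - 1) + (β * k - r) by omega, pow_add, mul_assoc]
end

section
/- Let r, p, α, β be positive integers, and let φ, ψ be functions of one complex variable analytic at 0 with φ(0) ≠ 0 and ψ(0) ≠ 0. Set f(t) = t^α·φ(t) and g(u) = u^β·ψ(u), and assume f(u^r) = g(u)^p for all u in some neighborhood of 0 in ℂ. Let j be a positive integer with j ≤ α and j ≤ p. Then the two functions u ↦ (r·u^{r−1})^j·f^{(j)}(u^r) and u ↦ (g′(u))^j·π^{(j)}(g(u)), where π(w) = w^p and f^{(j)}, π^{(j)} denote j-th derivatives, both have order of vanishing at 0 exactly equal to r·α − j; in particular these two orders of vanishing are equal. -/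
open Filter Topology

/-- If `F` and `G` vanish at `0` to the finite orders `a` and `b > 0`, then
`(G')ʲ · (F⁽ʲ⁾ ∘ G)` vanishes at `0` to order `b * a - j`, for `j ≤ a`. -/
theorem analyticOrderAt_deriv_pow_mul_iteratedDeriv_comp {F G : ℂ → ℂ}
    (hF : AnalyticAt ℂ F 0) (hG : AnalyticAt ℂ G 0) {a b j : ℕ}
    (hFa : analyticOrderAt F 0 = a) (hGb : analyticOrderAt G 0 = b)
    (ha : a ≠ 0) (hb : b ≠ 0) (hja : j ≤ a) :
    AnalyticAt ℂ (deriv G ^ j * iteratedDeriv j F ∘ G) 0 ∧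
      analyticOrderAt (deriv G ^ j * iteratedDeriv j F ∘ G) 0 = (b * a - j : ℕ) := by
  obtain ⟨b, rfl⟩ := Nat.exists_eq_succ_of_ne_zero hb
  have hG0 : G 0 = 0 := apply_eq_zero_of_analyticOrderAt_ne_zero (by rw [hGb]; exact_mod_cast hb)
  have hFj : AnalyticAt ℂ (iteratedDeriv j F) (G 0) := by
    rw [hG0, iteratedDeriv_eq_iterate]
    exact hF.iterated_deriv j
  have hFj_order : analyticOrderAt (iteratedDeriv j F) 0 = (a - j : ℕ) := by
    rw [iteratedDeriv_eq_iterate]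
    exact analyticOrderAt_iterated_deriv hF hFa.symm ha hja
  have hG'_order : analyticOrderAt (deriv G) 0 = b :=
    analyticOrderAt_deriv_of_pos hG (by simpa using hGb)
  have hcomp : AnalyticAt ℂ (iteratedDeriv j F ∘ G) 0 := hFj.comp hG
  refine ⟨(hG.deriv.pow j).mul hcomp, ?_⟩
  rw [analyticOrderAt_mul (hG.deriv.pow j) hcomp, analyticOrderAt_pow hG.deriv,
    hFj.analyticOrderAt_comp hG, hG0]
  simp only [sub_zero]
  rw [hFj_order, hG'_order, hGb, nsmul_eq_mul]
  norm_cast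
  obtain ⟨d, rfl⟩ := Nat.exists_eq_add_of_le hja
  rw [Nat.add_sub_cancel_left, eq_comm, Nat.sub_eq_iff_eq_add (by nlinarith)]
  simp only [Nat.succ_eq_add_one]
  ring

/-- A function `t ↦ t ^ n * φ t` with `φ` analytic and nonzero at `0` is analytic at `0` and
vanishes there to order `n`. -/
theorem analyticOrderAt_of_eq_pow_mul {F φ : ℂ → ℂ} {n : ℕ} (hφ : AnalyticAt ℂ φ 0)
    (hφ0 : φ 0 ≠ 0) (hF : ∀ t, F t = t ^ n * φ t) :
    AnalyticAt ℂ F 0 ∧ analyticOrderAt F 0 = n := by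
  have hFan : AnalyticAt ℂ F 0 := by
    rw [funext hF]
    exact (analyticAt_id.pow n).mul hφ
  exact ⟨hFan, hFan.analyticOrderAt_eq_natCast.2
    ⟨φ, hφ, hφ0, Eventually.of_forall fun t => by simpa using hF t⟩⟩

/-- Local model of a curve germ lifted through an adapted covering `π(w) = w^p` via
`ρ(u) = u^r`: for `1 ≤ j ≤ α`, `j ≤ p`, the functions `u ↦ (r u^{r-1})^j f^{(j)}(u^r)`
and `u ↦ (g'(u))^j π^{(j)}(g(u))` both vanish at `0` to order exactly `r·α - j`. -/
theorem jet_numerators_same_order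
    (r p α β : ℕ) (hr : 0 < r) (hp : 0 < p) (hα : 0 < α) (hβ : 0 < β)
    (φ ψ : ℂ → ℂ) (hφ : AnalyticAt ℂ φ 0) (hψ : AnalyticAt ℂ ψ 0)
    (hφ0 : φ 0 ≠ 0) (hψ0 : ψ 0 ≠ 0)
    (f g : ℂ → ℂ)
    (hf : ∀ t : ℂ, f t = t ^ α * φ t)
    (hg : ∀ u : ℂ, g u = u ^ β * ψ u)
    (hfg : ∀ᶠ u in 𝓝 (0 : ℂ), f (u ^ r) = g u ^ p)
    (j : ℕ) (hj : 0 < j) (hjα : j ≤ α) (hjp : j ≤ p) :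
    (∃ c : ℂ → ℂ, AnalyticAt ℂ c 0 ∧ c 0 ≠ 0 ∧
        ∀ᶠ u in 𝓝 (0 : ℂ),
          ((r : ℂ) * u ^ (r - 1)) ^ j * iteratedDeriv j f (u ^ r)
            = u ^ (r * α - j) * c u) ∧
    (∃ c : ℂ → ℂ, AnalyticAt ℂ c 0 ∧ c 0 ≠ 0 ∧
        ∀ᶠ u in 𝓝 (0 : ℂ),
          (deriv g u) ^ j * iteratedDeriv j (fun w : ℂ => w ^ p) (g u)
            = u ^ (r * α - j) * c u) := by
  obtain ⟨hfan, hford⟩ := analyticOrderAt_of_eq_pow_mul hφ hφ0 hf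
  obtain ⟨hgan, hgord⟩ := analyticOrderAt_of_eq_pow_mul hψ hψ0 hg
  have hpow (n : ℕ) : AnalyticAt ℂ (fun u : ℂ => u ^ n) 0 ∧
      analyticOrderAt (fun u : ℂ => u ^ n) 0 = n :=
    analyticOrderAt_of_eq_pow_mul (φ := fun _ => 1) analyticAt_const one_ne_zero (by simp)
  have hr0 : (0 : ℂ) ^ r = 0 := zero_pow hr.ne'
  have horders : r * α = β * p := by
    have hcomp := AnalyticAt.analyticOrderAt_comp (f := f) (g := fun u : ℂ => u ^ r) (z₀ := 0)
      (by simpa only [hr0] using hfan) (hpow r).1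
    have hgp : analyticOrderAt (f ∘ fun u : ℂ => u ^ r) 0 = analyticOrderAt (g ^ p) 0 :=
      analyticOrderAt_congr hfg
    simp only [hr0, sub_zero] at hcomp
    rw [hgp, analyticOrderAt_pow hgan, hford, hgord, (hpow r).2, nsmul_eq_mul] at hcomp
    norm_cast at hcomp
    linarith
  constructor
  · obtain ⟨han, hord⟩ := analyticOrderAt_deriv_pow_mul_iteratedDeriv_comp hfan (hpow r).1
      hford (hpow r).2 hα.ne' hr.ne' hjα
    simpa using han.analyticOrderAt_eq_natCast.1 hord
  · obtain ⟨han, hord⟩ := analyticOrderAt_deriv_pow_mul_iteratedDeriv_comp (hpow p).1 hgan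
      (hpow p).2 hgord hp.ne' hβ.ne' hjp
    rw [horders]
    simpa using han.analyticOrderAt_eq_natCast.1 hord
end

section
/- Let r, p, α, β be positive integers, and let φ, ψ be functions of one complex variable analytic at 0 with φ(0) ≠ 0 and ψ(0) ≠ 0. Set f(t) = t^α·φ(t) and g(u) = u^β·ψ(u), and assume f(u^r) = g(u)^p for all u in some neighborhood of 0 in ℂ. Let m be a positive integer dividing p and let j be an integer with 1 ≤ j < m and j ≤ α. Then there exists a function h analytic at 0 with f^{(j)}(u^r) = g(u)^{p(m−j)/m}·h(u) near 0 if and only if α ≥ m, where f^{(j)} denotes the j-th derivative of f. -/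
open Filter Topology

/-- Near a point, an analytic function `F` is divisible by an analytic function `G` of finite order
(with analytic quotient) if and only if `G` vanishes to at most the order of `F`. -/
theorem exists_analyticAt_eventually_eq_mul_iff_analyticOrderAt_le
    {𝕜 : Type*} [NontriviallyNormedField 𝕜] {F G : 𝕜 → 𝕜} {z₀ : 𝕜}
    (hF : AnalyticAt 𝕜 F z₀) (hG : AnalyticAt 𝕜 G z₀) (hG' : analyticOrderAt G z₀ ≠ ⊤) :
    (∃ h : 𝕜 → 𝕜, AnalyticAt 𝕜 h z₀ ∧ ∀ᶠ z in 𝓝 z₀, F z = G z * h z) ↔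
      analyticOrderAt G z₀ ≤ analyticOrderAt F z₀ := by
  constructor
  · rintro ⟨h, hh, hFG⟩
    have hFG' : F =ᶠ[𝓝 z₀] G * h := hFG
    rw [analyticOrderAt_congr hFG', analyticOrderAt_mul hG hh]
    exact le_self_add
  · intro hle
    obtain ⟨n, hn⟩ := ENat.ne_top_iff_exists.mp hG'
    obtain ⟨k, hk, hk0, hGk⟩ := hG.analyticOrderAt_eq_natCast.mp hn.symm
    rw [← hn] at hle
    obtain ⟨l, hl, hFl⟩ := (natCast_le_analyticOrderAt hF).mp hle
    refine ⟨fun z ↦ l z / k z, hl.div hk hk0, ?_⟩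
    filter_upwards [hGk, hFl, hk.continuousAt.eventually_ne hk0] with z hGz hFz hkz
    rw [hGz, hFz, smul_eq_mul, smul_eq_mul]
    field_simp

theorem analyticAt_and_analyticOrderAt_of_eq_pow_mul {𝕜 : Type*} [NontriviallyNormedField 𝕜]
    {f φ : 𝕜 → 𝕜} {n : ℕ} (hφ : AnalyticAt 𝕜 φ 0) (hφ0 : φ 0 ≠ 0)
    (hf : ∀ t, f t = t ^ n * φ t) :
    AnalyticAt 𝕜 f 0 ∧ analyticOrderAt f 0 = n := by
  have hfa : AnalyticAt 𝕜 f 0 := by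
    rw [funext hf]
    fun_prop
  exact ⟨hfa, hfa.analyticOrderAt_eq_natCast.mpr ⟨φ, hφ, hφ0, by simp [hf]⟩⟩

theorem analyticAt_and_analyticOrderAt_comp_pow {𝕜 : Type*} [NontriviallyNormedField 𝕜]
    {f : 𝕜 → 𝕜} {n r : ℕ}
    (hr : r ≠ 0) (hf : AnalyticAt 𝕜 f 0) (hn : analyticOrderAt f 0 = n) :
    AnalyticAt 𝕜 (fun u ↦ f (u ^ r)) 0 ∧
      analyticOrderAt (fun u ↦ f (u ^ r)) 0 = (n * r : ℕ) := by
  have hpow : AnalyticAt 𝕜 (fun u : 𝕜 ↦ u ^ r) 0 := by fun_prop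
  have hf' : AnalyticAt 𝕜 f ((fun u : 𝕜 ↦ u ^ r) 0) := by simpa [hr] using hf
  refine ⟨AnalyticAt.comp (f := fun u : 𝕜 ↦ u ^ r) hf' hpow, ?_⟩
  have hord : analyticOrderAt (fun u : 𝕜 ↦ u ^ r) 0 = r :=
    hpow.analyticOrderAt_eq_natCast.mpr ⟨fun _ ↦ 1, by fun_prop, by simp, by simp⟩
  have := AnalyticAt.analyticOrderAt_comp (g := fun u : 𝕜 ↦ u ^ r) hf' hpow
  simpa [Function.comp_def, hr, hn, hord] using this

/-- Local model of a curve germ lifted through an adapted covering `π(w) = w^p` via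
`ρ(u) = u^r`, with orbifold multiplicity `m ∣ p` and `1 ≤ j < m`, `j ≤ α`:
the `j`-th orbifold jet coordinate evaluates holomorphically, i.e. `f^{(j)}(u^r)` is
divisible by `g(u)^{p(m-j)/m}` with analytic quotient, if and only if `α ≥ m`. -/
theorem jet_coordinate_holomorphic_iff_orbifold
    (r p α β : ℕ) (hr : 0 < r) (hp : 0 < p) (hα : 0 < α) (hβ : 0 < β)
    (φ ψ : ℂ → ℂ) (hφ : AnalyticAt ℂ φ 0) (hψ : AnalyticAt ℂ ψ 0)
    (hφ0 : φ 0 ≠ 0) (hψ0 : ψ 0 ≠ 0)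
    (f g : ℂ → ℂ)
    (hf : ∀ t : ℂ, f t = t ^ α * φ t)
    (hg : ∀ u : ℂ, g u = u ^ β * ψ u)
    (hfg : ∀ᶠ u in 𝓝 (0 : ℂ), f (u ^ r) = g u ^ p)
    (m : ℕ) (hm : 0 < m) (hmp : m ∣ p)
    (j : ℕ) (hj : 1 ≤ j) (hjm : j < m) (hjα : j ≤ α) :
    (∃ h : ℂ → ℂ, AnalyticAt ℂ h 0 ∧
        ∀ᶠ u in 𝓝 (0 : ℂ),
          iteratedDeriv j f (u ^ r) = g u ^ (p * (m - j) / m) * h u) ↔ m ≤ α := by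
  obtain ⟨hfa, hfo⟩ := analyticAt_and_analyticOrderAt_of_eq_pow_mul hφ hφ0 hf
  obtain ⟨hga, hgo⟩ := analyticAt_and_analyticOrderAt_of_eq_pow_mul hψ hψ0 hg
  have hrel : α * r = p * β := by
    have h := analyticOrderAt_congr (show (fun u ↦ f (u ^ r)) =ᶠ[𝓝 0] g ^ p from hfg)
    rw [(analyticAt_and_analyticOrderAt_comp_pow hr.ne' hfa hfo).2,
      analyticOrderAt_pow hga, hgo, nsmul_eq_mul] at h
    exact_mod_cast h
  have hda : AnalyticAt ℂ (iteratedDeriv j f) 0 := by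
    rw [iteratedDeriv_eq_iterate]
    exact hfa.iterated_deriv j
  have hdo : analyticOrderAt (iteratedDeriv j f) 0 = (α - j : ℕ) := by
    rw [iteratedDeriv_eq_iterate]
    exact_mod_cast analyticOrderAt_iterated_deriv hfa hfo.symm hα.ne' hjα
  obtain ⟨hFa, hFo⟩ := analyticAt_and_analyticOrderAt_comp_pow hr.ne' hda hdo
  have hGo : analyticOrderAt (g ^ (p * (m - j) / m)) 0 = (p * (m - j) / m * β : ℕ) := by
    rw [analyticOrderAt_pow hga, hgo, nsmul_eq_mul, Nat.cast_mul]
  refine (exists_analyticAt_eventually_eq_mul_iff_analyticOrderAt_le hFa (hga.pow _)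
    (by rw [hGo]; exact ENat.natCast_ne_top _)).trans ?_
  rw [hGo, hFo, Nat.cast_le]
  obtain ⟨q, rfl⟩ := hmp
  obtain ⟨a, rfl⟩ := Nat.exists_eq_add_of_le hjα
  obtain ⟨b, rfl⟩ := Nat.exists_eq_add_of_lt hjm
  rw [mul_assoc, Nat.mul_div_cancel_left _ hm]
  simp only [add_assoc, Nat.add_sub_cancel_left] at hrel ⊢
  rw [← mul_le_mul_iff_right₀ hm]
  have hle : (j + b + 1) * (q * (b + 1) * β) = (b + 1) * ((j + a) * r) := by
    rw [hrel]
    ring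
  have hrj : 0 < r * j := by positivity
  rw [← add_assoc, hle, show j + b + 1 ≤ j + a ↔ b + 1 ≤ a by lia,
    show (b + 1) * ((j + a) * r) = r * j * (b + 1) + (b + 1) * a * r by ring,
    show (j + b + 1) * (a * r) = r * j * a + (b + 1) * a * r by ring,
    add_le_add_iff_right, mul_le_mul_iff_right₀ hrj]
end

section
/- Let d ≥ 1 be an integer, let a₁, …, a_d be positive integers with gcd(a₁, …, a_d) = 1, and let q₁, …, q_d be nonnegative integers; write Q = q₁ + ⋯ + q_d. Then, as N → ∞, the sum of x₁^{q₁}⋯x_d^{q_d} over all tuples (x₁, …, x_d) of nonnegative integers with a₁x₁ + ⋯ + a_d x_d = N equals N^{d−1+Q}·( (q₁!⋯q_d!)/((d−1+Q)!·a₁^{q₁+1}⋯a_d^{q_d+1}) + o(1) ). -/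
open Filter Topology

open Asymptotics Finset

/-- The Cauchy product of `O(n ^ p)` and `o(n ^ s)` is `o(n ^ (p + s + 1))`. -/
theorem isLittleO_sum_antidiagonal {f h : ℕ → ℝ} {p s : ℕ}
    (hf : f =O[⊤] fun n : ℕ => ((n : ℝ) + 1) ^ p)
    (hh : h =o[atTop] fun n : ℕ => ((n : ℝ) + 1) ^ s) :
    (fun N : ℕ => ∑ x ∈ antidiagonal N, f x.1 * h x.2) =o[atTop]
      fun n : ℕ => ((n : ℝ) + 1) ^ (p + s + 1) := by
  obtain ⟨C, hC⟩ := isBigO_top.1 hf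
  have hsum_ge (n : ℕ) : (n : ℝ) ≤ ∑ i ∈ range n, ((i : ℝ) + 1) ^ s := by
    calc (n : ℝ) = ∑ i ∈ range n, (1 : ℝ) := by simp
      _ ≤ _ := sum_le_sum fun i _ => one_le_pow₀ (by linarith [Nat.cast_nonneg (α := ℝ) i])
  have hsum_le (n : ℕ) :
      ∑ i ∈ range (n + 1), ((i : ℝ) + 1) ^ s ≤ ((n : ℝ) + 1) ^ (s + 1) := by
    calc ∑ i ∈ range (n + 1), ((i : ℝ) + 1) ^ s
        ≤ ∑ i ∈ range (n + 1), ((n : ℝ) + 1) ^ s := by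
          refine sum_le_sum fun i hi => ?_
          have : (i : ℝ) ≤ n := by exact_mod_cast Nat.lt_succ_iff.1 (mem_range.1 hi)
          gcongr
      _ = _ := by simp [pow_succ']
  have hpartial : (fun n : ℕ => ∑ i ∈ range (n + 1), ‖h i‖) =o[atTop]
      fun n : ℕ => ((n : ℝ) + 1) ^ (s + 1) := by
    refine ((hh.norm_left.sum_range (fun i => by positivity)
      (tendsto_atTop_mono hsum_ge tendsto_natCast_atTop_atTop)).comp_tendsto
        (tendsto_add_atTop_nat 1)).trans_isBigO (IsBigO.of_norm_le fun n => ?_)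
    rw [Function.comp_apply, Real.norm_of_nonneg (sum_nonneg fun i _ => by positivity)]
    exact hsum_le n
  have hbound (N : ℕ) : ‖∑ x ∈ antidiagonal N, f x.1 * h x.2‖ ≤
      C * ‖((N : ℝ) + 1) ^ p * ∑ i ∈ range (N + 1), ‖h i‖‖ := by
    rw [Real.norm_of_nonneg (mul_nonneg (by positivity) (sum_nonneg fun i _ => norm_nonneg _))]
    have hC0 : 0 ≤ C := by
      have := (norm_nonneg _).trans (hC 0)
      simpa using this
    have hrefl : ∑ i ∈ range (N + 1), ‖h i‖ = ∑ x ∈ antidiagonal N, ‖h x.2‖ := by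
      rw [← Nat.sum_antidiagonal_swap, Nat.sum_antidiagonal_eq_sum_range_succ_mk]
      rfl
    rw [hrefl, mul_sum, mul_sum]
    refine norm_sum_le_of_le _ fun x hx => ?_
    rw [norm_mul, ← mul_assoc]
    gcongr
    refine (hC x.1).trans ?_
    rw [Real.norm_of_nonneg (by positivity)]
    have : (x.1 : ℝ) ≤ N := by exact_mod_cast HasAntidiagonal.antidiagonal.fst_le hx
    gcongr
  refine (IsBigO.of_bound C (.of_forall hbound)).trans_isLittleO ?_
  simpa only [pow_add, mul_assoc, pow_one] using
    (isBigO_refl (fun n : ℕ => ((n : ℝ) + 1) ^ p) atTop).mul_isLittleO hpartial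

/-- Abel summation against a weight with bounded partial sums. -/
theorem abs_sum_mul_mul_le {α β w : ℕ → ℝ} {D : ℝ} (hα : Monotone α) (hα0 : ∀ i, 0 ≤ α i)
    (hβ : Antitone β) (hβ0 : ∀ i, 0 ≤ β i) (hw : ∀ n, |∑ i ∈ range n, w i| ≤ D) (N : ℕ) :
    |∑ i ∈ range (N + 1), α i * β i * w i| ≤ 3 * D * (α N * β 0) := by
  have hD : 0 ≤ D := (abs_nonneg _).trans (hw 0)
  have hparts := sum_range_by_parts (fun i => α i * β i) w (N + 1)
  simp only [smul_eq_mul, Nat.add_sub_cancel] at hparts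
  have hterm (i : ℕ) (hi : i ∈ range N) :
      |(α (i + 1) * β (i + 1) - α i * β i) * ∑ j ∈ range (i + 1), w j| ≤
        D * (α N * (β i - β (i + 1)) + β 0 * (α (i + 1) - α i)) := by
    have h1 : 0 ≤ β i - β (i + 1) := sub_nonneg.2 (hβ i.le_succ)
    have h2 : 0 ≤ α (i + 1) - α i := sub_nonneg.2 (hα i.le_succ)
    have h3 : α (i + 1) ≤ α N := hα (mem_range.1 hi)
    have h4 : β i ≤ β 0 := hβ i.zero_le
    rw [abs_mul, mul_comm]
    refine mul_le_mul (hw _) ?_ (abs_nonneg _) hD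
    have h5 := mul_le_mul_of_nonneg_right h3 h1
    have h6 := mul_le_mul_of_nonneg_right h4 h2
    have h7 := mul_nonneg (hα0 (i + 1)) h1
    have h8 := mul_nonneg (hβ0 i) h2
    rw [abs_le]
    constructor <;> linarith
  have hβN : β N * α N ≤ β 0 * α N := mul_le_mul_of_nonneg_right (hβ N.zero_le) (hα0 N)
  have htel : ∑ i ∈ range N, D * (α N * (β i - β (i + 1)) + β 0 * (α (i + 1) - α i)) =
      D * (α N * (β 0 - β N) + β 0 * (α N - α 0)) := by
    rw [← mul_sum, sum_add_distrib, ← mul_sum, ← mul_sum, sum_range_sub, sum_range_sub']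
  have hfirst : |α N * β N * ∑ i ∈ range (N + 1), w i| ≤ D * (α N * β 0) := by
    rw [abs_mul, mul_comm, abs_of_nonneg (mul_nonneg (hα0 N) (hβ0 N))]
    exact mul_le_mul (hw _) (by linarith) (mul_nonneg (hα0 N) (hβ0 N)) hD
  calc _ ≤ D * (α N * β 0) + D * (α N * (β 0 - β N) + β 0 * (α N - α 0)) := by
        rw [hparts]
        refine (abs_sub _ _).trans (add_le_add hfirst ?_)
        exact ((abs_sum_le_sum_abs _ _).trans (sum_le_sum hterm)).trans htel.le
    _ ≤ _ := by
        have h1 := mul_nonneg hD (mul_nonneg (hα0 N) (hβ0 N))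
        have h2 := mul_nonneg hD (mul_nonneg (hβ0 0) (hα0 0))
        linarith

/-- The residue class `r` mod `L` has density `1 / L`, with bounded discrepancy. -/
theorem abs_sum_range_modEq_sub_le {L : ℕ} (hL : 0 < L) (r n : ℕ) :
    |∑ i ∈ range n, ((L : ℝ) * (if i ≡ r [MOD L] then 1 else 0) - 1)| ≤ L := by
  have hcount : ∑ i ∈ range n, (if i ≡ r [MOD L] then (1 : ℝ) else 0) =
      (n / L : ℕ) + if r % L < n % L then 1 else 0 := by
    rw [sum_boole, ← Nat.count_eq_card_filter_range, Nat.count_modEq_card n hL r]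
    push_cast
    rfl
  rw [sum_sub_distrib, ← mul_sum, hcount]
  have hdiv : (L : ℝ) * (n / L : ℕ) + (n % L : ℕ) = n := by exact_mod_cast Nat.div_add_mod n L
  have hmod : ((n % L : ℕ) : ℝ) ≤ L := by exact_mod_cast (Nat.mod_lt n hL).le
  have hmod0 : (0 : ℝ) ≤ (n % L : ℕ) := Nat.cast_nonneg _
  simp only [sum_const, card_range, nsmul_eq_mul, mul_one]
  rw [abs_le]
  split_ifs <;> constructor <;> linarith

theorem sum_antidiagonal_choose_add_mul_choose_add (p s N : ℕ) :
    ∑ x ∈ antidiagonal N, ((x.1 + p).choose p : ℝ) * ((x.2 + s).choose s : ℝ) =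
      ((N + (p + s + 1)).choose (p + s + 1) : ℝ) := by
  have h : ((PowerSeries.mk 1 : PowerSeries ℝ) ^ (p + 1)) * PowerSeries.mk 1 ^ (s + 1) =
      PowerSeries.mk 1 ^ (p + s + 1 + 1) := by ring
  simp only [PowerSeries.mk_one_pow_eq_mk_choose_add] at h
  simpa [PowerSeries.coeff_mul, add_comm] using congrArg (PowerSeries.coeff N) h

theorem exists_modEq_lcm_iff {g₁ g₂ N : ℕ} (h : Nat.gcd g₁ g₂ ∣ N) :
    ∃ r, ∀ i ≤ N, (g₁ ∣ i ∧ g₂ ∣ N - i) ↔ i ≡ r [MOD Nat.lcm g₁ g₂] := by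
  obtain ⟨r, hr₁, hr₂⟩ := Nat.chineseRemainder' ((Nat.modEq_zero_iff_dvd.2 h).symm)
  refine ⟨r, fun i hi => ?_⟩
  rw [← Nat.modEq_zero_iff_dvd, ← Nat.modEq_iff_dvd' hi]
  refine ⟨fun ⟨h₁, h₂⟩ => Nat.mod_lcm (h₁.trans hr₁.symm) (h₂.trans hr₂.symm), fun h => ?_⟩
  exact ⟨(h.of_dvd (Nat.dvd_lcm_left _ _)).trans hr₁, (h.of_dvd (Nat.dvd_lcm_right _ _)).trans hr₂⟩

/-- The model sequence of degree `m` supported on the multiples of `g`. -/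
noncomputable def chooseOnMultiples (g m n : ℕ) : ℝ :=
  if g ∣ n then ((n + m).choose m : ℝ) else 0

theorem isBigO_chooseOnMultiples (g m : ℕ) :
    chooseOnMultiples g m =O[⊤] fun n : ℕ => ((n : ℝ) + 1) ^ m := by
  refine IsBigO.of_bound 1 (.of_forall fun n => ?_)
  have h : ((n + m).choose m : ℝ) ≤ ((n : ℝ) + 1) ^ m := by
    exact_mod_cast Nat.choose_add_le_add_one_pow n m
  rw [one_mul, Real.norm_of_nonneg (r := ((n : ℝ) + 1) ^ m) (by positivity), chooseOnMultiples]
  split_ifs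
  · rwa [Real.norm_natCast]
  · rw [norm_zero]
    positivity

theorem abs_sum_antidiagonal_chooseOnMultiples_sub_le {g₁ g₂ : ℕ} (h₁ : 0 < g₁) (h₂ : 0 < g₂)
    (p s N : ℕ) :
    |∑ x ∈ antidiagonal N, chooseOnMultiples g₁ p x.1 * chooseOnMultiples g₂ s x.2 -
      (Nat.lcm g₁ g₂ : ℝ)⁻¹ * chooseOnMultiples (Nat.gcd g₁ g₂) (p + s + 1) N| ≤
      3 * ((N : ℝ) + 1) ^ (p + s) := by
  by_cases hN : Nat.gcd g₁ g₂ ∣ N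
  · obtain ⟨r, hr⟩ := exists_modEq_lcm_iff hN
    have hL : 0 < Nat.lcm g₁ g₂ := Nat.lcm_pos h₁ h₂
    set L := Nat.lcm g₁ g₂
    have hLR : (0 : ℝ) < L := by exact_mod_cast hL
    let α : ℕ → ℝ := fun i => ((i + p).choose p : ℝ)
    let β : ℕ → ℝ := fun i => ((N - i + s).choose s : ℝ)
    have hfull : ∑ i ∈ range (N + 1), α i * β i =
        ((N + (p + s + 1)).choose (p + s + 1) : ℝ) := by
      rw [← sum_antidiagonal_choose_add_mul_choose_add,
        Nat.sum_antidiagonal_eq_sum_range_succ_mk]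
    have hconv : ∑ x ∈ antidiagonal N, chooseOnMultiples g₁ p x.1 * chooseOnMultiples g₂ s x.2 =
        ∑ i ∈ range (N + 1), α i * β i * (if i ≡ r [MOD L] then 1 else 0) := by
      rw [Nat.sum_antidiagonal_eq_sum_range_succ_mk]
      refine sum_congr rfl fun i hi => ?_
      simp only [← hr i (Nat.lt_succ_iff.1 (mem_range.1 hi)), chooseOnMultiples, α, β, ite_and]
      split_ifs <;> simp
    have hAbel := abs_sum_mul_mul_le (α := α) (β := β)
      (fun i j hij => Nat.cast_le.2 (Nat.choose_le_choose p (by omega)))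
      (fun i => Nat.cast_nonneg _)
      (fun i j hij => Nat.cast_le.2 (Nat.choose_le_choose s (by omega)))
      (fun i => Nat.cast_nonneg _) (abs_sum_range_modEq_sub_le hL r) N
    have hα : α N ≤ ((N : ℝ) + 1) ^ p := by
      simp only [α]
      exact_mod_cast Nat.choose_add_le_add_one_pow N p
    have hβ : β 0 ≤ ((N : ℝ) + 1) ^ s := by
      simp only [β, Nat.sub_zero]
      exact_mod_cast Nat.choose_add_le_add_one_pow N s
    have hαβ : α N * β 0 ≤ ((N : ℝ) + 1) ^ (p + s) := by
      rw [pow_add]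
      exact mul_le_mul hα hβ (Nat.cast_nonneg _) (by positivity)
    rw [hconv, chooseOnMultiples, if_pos hN, ← hfull]
    have hrewrite : ∑ i ∈ range (N + 1),
        α i * β i * ((L : ℝ) * (if i ≡ r [MOD L] then 1 else 0) - 1) =
        L * (∑ i ∈ range (N + 1), α i * β i * (if i ≡ r [MOD L] then 1 else 0) -
          (L : ℝ)⁻¹ * ∑ i ∈ range (N + 1), α i * β i) := by
      rw [mul_sub, mul_inv_cancel_left₀ hLR.ne', mul_sum, ← sum_sub_distrib]
      exact sum_congr rfl fun i _ => by ring
    rw [hrewrite, abs_mul, abs_of_pos hLR] at hAbel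
    refine le_of_mul_le_mul_left (hAbel.trans ?_) hLR
    nlinarith
  · have hzero : ∑ x ∈ antidiagonal N,
        chooseOnMultiples g₁ p x.1 * chooseOnMultiples g₂ s x.2 = 0 := by
      refine sum_eq_zero fun x hx => ?_
      simp only [chooseOnMultiples]
      split_ifs with hx₁ hx₂
      any_goals simp
      refine absurd ?_ hN
      rw [← mem_antidiagonal.1 hx]
      exact dvd_add ((Nat.gcd_dvd_left _ _).trans hx₁) ((Nat.gcd_dvd_right _ _).trans hx₂)
    rw [hzero, chooseOnMultiples, if_neg hN]
    simpa using (by positivity : (0 : ℝ) ≤ ((N : ℝ) + 1) ^ (p + s))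

theorem isLittleO_add_one_pow {k m : ℕ} (h : k < m) :
    (fun n : ℕ => ((n : ℝ) + 1) ^ k) =o[atTop] fun n : ℕ => ((n : ℝ) + 1) ^ m :=
  (isLittleO_pow_pow_atTop_of_lt h).comp_tendsto
    (tendsto_natCast_atTop_atTop.atTop_add tendsto_const_nhds)

/-- `f n = c * (n + m).choose m + o(n ^ m)` along the multiples of `g`, and `f n = o(n ^ m)`
elsewhere. -/
def HasMultiplesAsymptotic (f : ℕ → ℝ) (g m : ℕ) (c : ℝ) : Prop :=
  (fun n => f n - c * chooseOnMultiples g m n) =o[atTop] fun n : ℕ => ((n : ℝ) + 1) ^ m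

theorem HasMultiplesAsymptotic.isBigO {f : ℕ → ℝ} {g m : ℕ} {c : ℝ}
    (hf : HasMultiplesAsymptotic f g m c) : f =O[⊤] fun n : ℕ => ((n : ℝ) + 1) ^ m := by
  have h : f =O[atTop] fun n : ℕ => ((n : ℝ) + 1) ^ m := by
    simpa using IsLittleO.isBigO hf |>.add
      (((isBigO_chooseOnMultiples g m).mono le_top).const_mul_left c)
  exact h.nat_of_atTop (.of_forall fun n hn => absurd hn (by positivity))

theorem HasMultiplesAsymptotic.sum_antidiagonal {f h : ℕ → ℝ} {g₁ g₂ p s : ℕ} {c₁ c₂ : ℝ}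
    (h₁ : 0 < g₁) (h₂ : 0 < g₂) (hf : HasMultiplesAsymptotic f g₁ p c₁)
    (hh : HasMultiplesAsymptotic h g₂ s c₂) :
    HasMultiplesAsymptotic (fun N => ∑ x ∈ antidiagonal N, f x.1 * h x.2) (Nat.gcd g₁ g₂)
      (p + s + 1) (c₁ * c₂ / Nat.lcm g₁ g₂) := by
  have hmain : (fun N => ∑ x ∈ antidiagonal N,
      chooseOnMultiples g₁ p x.1 * chooseOnMultiples g₂ s x.2 -
      (Nat.lcm g₁ g₂ : ℝ)⁻¹ * chooseOnMultiples (Nat.gcd g₁ g₂) (p + s + 1) N) =o[atTop]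
      fun n : ℕ => ((n : ℝ) + 1) ^ (p + s + 1) := by
    refine (IsBigO.of_bound 3 (.of_forall fun N => ?_)).trans_isLittleO
      (isLittleO_add_one_pow (p + s).lt_succ_self)
    rw [Real.norm_of_nonneg (r := ((N : ℝ) + 1) ^ (p + s)) (by positivity)]
    exact abs_sum_antidiagonal_chooseOnMultiples_sub_le h₁ h₂ p s N
  have hright := isLittleO_sum_antidiagonal (isBigO_chooseOnMultiples g₁ p) hh
  have hleft := isLittleO_sum_antidiagonal hh.isBigO hf
  rw [add_comm s p] at hleft
  refine (((hmain.const_mul_left (c₁ * c₂)).add (hright.const_mul_left c₁)).add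
    hleft).congr_left fun N => ?_
  rw [← Nat.sum_antidiagonal_swap (f := fun x => h x.1 * _), mul_sub, mul_sum, mul_sum,
    sub_add_eq_add_sub, sub_add_eq_add_sub, ← sum_add_distrib, ← sum_add_distrib]
  congr 1
  · exact sum_congr rfl fun x _ => by simp only [Prod.fst_swap, Prod.snd_swap]; ring
  · ring

theorem tendsto_choose_add_div_pow (m : ℕ) :
    Tendsto (fun n : ℕ => ((n + m).choose m : ℝ) / (n : ℝ) ^ m) atTop
      (𝓝 ((m.factorial : ℝ)⁻¹)) := by
  have hratio : Tendsto (fun n : ℕ => ((n + m : ℕ) : ℝ) / n) atTop (𝓝 1) := by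
    have h : Tendsto (fun n : ℕ => 1 + (m : ℝ) / n) atTop (𝓝 (1 + 0)) :=
      tendsto_const_nhds.add (tendsto_const_div_atTop_nhds_zero_nat _)
    rw [add_zero] at h
    refine h.congr' ?_
    filter_upwards [eventually_gt_atTop 0] with n hn
    have : (n : ℝ) ≠ 0 := by positivity
    push_cast
    field_simp
  have hchoose := ((isEquivalent_choose m).comp_tendsto (tendsto_add_atTop_nat m)).div
    (IsEquivalent.refl (u := fun n : ℕ => (n : ℝ) ^ m))
  refine hchoose.symm.tendsto_nhds ?_
  have h := (hratio.pow m).mul_const ((m.factorial : ℝ)⁻¹)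
  rw [one_pow, one_mul] at h
  refine h.congr fun n => ?_
  simp only [Function.comp_apply, Pi.div_apply, div_pow]
  ring

theorem isBigO_add_one_pow (m : ℕ) :
    (fun n : ℕ => ((n : ℝ) + 1) ^ m) =O[atTop] fun n : ℕ => (n : ℝ) ^ m := by
  refine IsBigO.pow (IsBigO.of_bound 2 ?_) m
  filter_upwards [eventually_ge_atTop 1] with n hn
  have : (1 : ℝ) ≤ n := by exact_mod_cast hn
  rw [Real.norm_of_nonneg (by positivity), Real.norm_of_nonneg (by positivity)]
  linarith

/-- The coefficients of `∑ x, x ^ q * t ^ (a * x)`. -/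
theorem hasMultiplesAsymptotic_pow {a : ℕ} (ha : 0 < a) (q : ℕ) :
    HasMultiplesAsymptotic (fun n => if a ∣ n then ((n / a : ℕ) : ℝ) ^ q else 0) a q
      (a * ((q.factorial : ℝ) / (a : ℝ) ^ (q + 1))) := by
  have haR : (a : ℝ) ≠ 0 := by positivity
  have hqR : (q.factorial : ℝ) ≠ 0 := by positivity
  have h : (fun n : ℕ => (n : ℝ) ^ q - q.factorial * ((n + q).choose q : ℝ)) =o[atTop]
      fun n : ℕ => ((n : ℝ) + 1) ^ q := by
    have hlim : (fun n : ℕ => (n : ℝ) ^ q - q.factorial * ((n + q).choose q : ℝ)) =o[atTop]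
        fun n : ℕ => (n : ℝ) ^ q := by
      refine (isLittleO_iff_tendsto' ?_).2 ?_
      · filter_upwards [eventually_gt_atTop 0] with n hn h0
        exact absurd h0 (by positivity)
      · have ht := ((tendsto_choose_add_div_pow q).const_mul (q.factorial : ℝ)).const_sub 1
        rw [mul_inv_cancel₀ hqR, sub_self] at ht
        refine ht.congr' ?_
        filter_upwards [eventually_gt_atTop 0] with n hn
        have : (n : ℝ) ≠ 0 := by positivity
        field_simp
    refine hlim.trans_isBigO (IsBigO.of_norm_le fun n => ?_)
    rw [Real.norm_of_nonneg (by positivity)]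
    gcongr
    linarith
  refine (IsBigO.of_bound ‖((a : ℝ) ^ q)⁻¹‖ (.of_forall fun n => ?_)).trans_isLittleO h
  simp only [chooseOnMultiples]
  split_ifs with hn
  · rw [← norm_mul, Nat.cast_div hn haR, div_pow]
    refine le_of_eq (congrArg _ ?_)
    field_simp
    ring
  · rw [mul_zero, sub_zero, norm_zero]
    positivity

theorem hasMultiplesAsymptotic_coeff_prod {ι : Type*} (a q : ι → ℕ) (ha : ∀ i, 0 < a i)
    {t : Finset ι} (ht : t.Nonempty) :
    HasMultiplesAsymptotic
      (fun N => PowerSeries.coeff N (∏ i ∈ t, PowerSeries.mk fun n =>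
        if a i ∣ n then ((n / a i : ℕ) : ℝ) ^ q i else 0))
      (t.gcd a) (#t - 1 + ∑ i ∈ t, q i)
      (t.gcd a * ∏ i ∈ t, ((q i).factorial : ℝ) / (a i : ℝ) ^ (q i + 1)) := by
  induction ht using Finset.Nonempty.cons_induction with
  | singleton i => simpa using hasMultiplesAsymptotic_pow (ha i) (q i)
  | cons i t hi ht ih =>
    have hg : 0 < t.gcd a := by
      obtain ⟨j, hj⟩ := ht
      exact Nat.pos_of_dvd_of_pos (gcd_dvd hj) (ha j)
    have hstep := (hasMultiplesAsymptotic_pow (ha i) (q i)).sum_antidiagonal (ha i) hg ih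
    have hgcd : (cons i t hi).gcd a = Nat.gcd (a i) (t.gcd a) := by
      classical
      rw [cons_eq_insert, gcd_insert]
      rfl
    have hdeg : #(cons i t hi) - 1 + ∑ j ∈ cons i t hi, q j =
        q i + (#t - 1 + ∑ j ∈ t, q j) + 1 := by
      rw [card_cons, sum_cons]
      have := ht.card_pos
      omega
    rw [hgcd, hdeg]
    convert hstep using 1
    · funext N
      rw [prod_cons, PowerSeries.coeff_mul]
      simp only [PowerSeries.coeff_mk]
    · have hlcm : ((Nat.gcd (a i) (t.gcd a) : ℕ) : ℝ) * (Nat.lcm (a i) (t.gcd a) : ℕ) =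
          a i * (t.gcd a : ℕ) := by exact_mod_cast Nat.gcd_mul_lcm _ _
      have hL : ((Nat.lcm (a i) (t.gcd a) : ℕ) : ℝ) ≠ 0 := by
        exact_mod_cast (Nat.lcm_pos (ha i) hg).ne'
      rw [eq_div_iff hL, prod_cons, mul_right_comm, hlcm]
      ring

theorem coeff_prod_eq_sum_filter {ι : Type*} [Fintype ι] [DecidableEq ι] (a q : ι → ℕ)
    (ha : ∀ i, 0 < a i) (N : ℕ) :
    PowerSeries.coeff N (∏ i, PowerSeries.mk fun n =>
        if a i ∣ n then ((n / a i : ℕ) : ℝ) ^ q i else 0) =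
      ∑ x ∈ (Fintype.piFinset fun _ : ι => range (N + 1)).filter (fun x => ∑ i, a i * x i = N),
        ∏ i, (x i : ℝ) ^ q i := by
  rw [PowerSeries.coeff_prod]
  simp only [PowerSeries.coeff_mk]
  symm
  refine sum_of_injOn (fun x => Finsupp.equivFunOnFinite.symm fun i => a i * x i) ?_ ?_ ?_ ?_
  · intro x _ y _ hxy
    funext i
    have := DFunLike.congr_fun hxy i
    exact Nat.eq_of_mul_eq_mul_left (ha i) (by simpa using this)
  · intro x hx
    simpa using (mem_filter.1 hx).2
  · intro l hl hl'
    rw [mem_finsuppAntidiag] at hl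
    by_contra hne
    have hdvd (i : ι) : a i ∣ l i := by
      by_contra hi
      exact hne (prod_eq_zero (mem_univ i) (if_neg hi))
    refine hl' ⟨fun i => l i / a i, ?_, ?_⟩
    · simp only [coe_filter, Fintype.mem_piFinset, mem_range, Set.mem_ofPred_eq,
        Nat.mul_div_cancel' (hdvd _)]
      refine ⟨fun i => Nat.lt_succ_iff.2 ((Nat.div_le_self _ _).trans ?_), hl.1⟩
      rw [← hl.1]
      exact single_le_sum (f := l) (fun _ _ => Nat.zero_le _) (mem_univ i)
    · ext i
      simp [Nat.mul_div_cancel' (hdvd i)]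
  · intro x _
    refine prod_congr rfl fun i _ => ?_
    simp [Nat.mul_div_cancel_left _ (ha i)]

/-- Sum–integral formula: for positive integer weights `aᵢ` with `gcd(a₁,…,a_d) = 1`
and exponents `qᵢ ∈ ℕ` with `Q = Σ qᵢ`, as `N → ∞`,
`Σ_{Σ aᵢxᵢ = N, xᵢ ∈ ℕ} Π xᵢ^{qᵢ} = N^{d-1+Q}·((Π qᵢ!)/((d-1+Q)!·Π aᵢ^{qᵢ+1}) + o(1))`.
Since each `aᵢ ≥ 1`, every solution satisfies `xᵢ ≤ N`, so the sum below ranges over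
all solutions. -/
theorem sum_integral_formula_weighted_simplex
    (d : ℕ) (hd : 1 ≤ d) (a : Fin d → ℕ) (ha : ∀ i, 0 < a i)
    (hgcd : Finset.univ.gcd a = 1) (q : Fin d → ℕ) :
    Tendsto
      (fun N : ℕ =>
        (∑ x ∈ (Fintype.piFinset fun _ : Fin d => Finset.range (N + 1)).filter
            (fun x => ∑ i, a i * x i = N),
          ∏ i, (x i : ℝ) ^ q i) / (N : ℝ) ^ (d - 1 + ∑ i, q i))
      atTop
      (𝓝 ((∏ i, ((q i).factorial : ℝ)) /
        (((d - 1 + ∑ i, q i).factorial : ℝ) * ∏ i, (a i : ℝ) ^ (q i + 1)))) := by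
  have : Nonempty (Fin d) := ⟨⟨0, hd⟩⟩
  have h := hasMultiplesAsymptotic_coeff_prod a q ha univ_nonempty
  rw [HasMultiplesAsymptotic, hgcd, card_univ, Fintype.card_fin] at h
  simp only [coeff_prod_eq_sum_filter a q ha, chooseOnMultiples, one_dvd, if_true, Nat.cast_one,
    one_mul] at h
  have hsub := (h.trans_isBigO (isBigO_add_one_pow _)).tendsto_div_nhds_zero
  have hlim := hsub.add ((tendsto_choose_add_div_pow (d - 1 + ∑ i, q i)).const_mul
    (∏ i, ((q i).factorial : ℝ) / (a i : ℝ) ^ (q i + 1)))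
  convert! hlim using 2
  · ring
  · rw [zero_add, prod_div_distrib, div_mul_eq_div_div_swap, div_eq_mul_inv (_ / _)]
end

section
/- Fix integers q ≥ 1 and i ≥ 0. For k > i, let S(k) be the sum, over all nondecreasing tuples of integers i+1 ≤ m₁ ≤ m₂ ≤ ⋯ ≤ m_q ≤ k, of the products 1/(m₁·m₂⋯m_q); that is, S(k) is the complete homogeneous symmetric function of degree q evaluated at (1/(i+1), 1/(i+2), …, 1/k). Then S(k) = (log k)^q/q! + O((log k)^{q−1}) as k → ∞; i.e., the function k ↦ S(k) − (log k)^q/q! is big-O of (log k)^{q−1} along k → ∞. -/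
open Filter Topology Asymptotics

/-- `S(k)`: the complete homogeneous symmetric function of degree `q` evaluated at
`(1/(i+1), 1/(i+2), …, 1/k)`, i.e. the sum over all nondecreasing tuples
`i+1 ≤ m₁ ≤ ⋯ ≤ m_q ≤ k` of `1/(m₁⋯m_q)`. -/
noncomputable def harmonicCompleteHomogeneous (q i k : ℕ) : ℝ :=
  ∑ m ∈ (Fintype.piFinset fun _ : Fin q => Finset.Icc (i + 1) k).filter
      (fun m => ∀ s t : Fin q, s ≤ t → m s ≤ m t),
    ∏ t : Fin q, (1 : ℝ) / (m t : ℝ)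

/-- Splitting off the largest part of a nondecreasing tuple. -/
theorem harmonicCompleteHomogeneous_succ (q i k : ℕ) :
    harmonicCompleteHomogeneous (q + 1) i k =
      ∑ n ∈ Finset.Icc (i + 1) k, harmonicCompleteHomogeneous q i n * (1 / (n : ℝ)) := by
  unfold harmonicCompleteHomogeneous
  simp_rw [Finset.sum_mul]
  rw [Finset.sum_sigma']
  refine Finset.sum_bij'
    (fun m _ => (⟨m (Fin.last q), Fin.init m⟩ : Σ _ : ℕ, Fin q → ℕ))
    (fun p _ => Fin.snoc (α := fun _ => ℕ) p.2 p.1) ?_ ?_ ?_ ?_ ?_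
  · intro m hm
    simp only [Finset.mem_filter, Fintype.mem_piFinset, Finset.mem_Icc] at hm
    simp only [Finset.mem_sigma, Finset.mem_filter, Fintype.mem_piFinset, Finset.mem_Icc, Fin.init]
    exact ⟨hm.1 _, fun t => ⟨(hm.1 _).1, hm.2 _ _ (Fin.le_last _)⟩,
      fun s t hst => hm.2 _ _ (Fin.castSucc_le_castSucc_iff.2 hst)⟩
  · rintro ⟨n, m⟩ hm
    simp only [Finset.mem_sigma, Finset.mem_filter, Fintype.mem_piFinset, Finset.mem_Icc] at hm
    simp only [Finset.mem_filter, Fintype.mem_piFinset, Finset.mem_Icc]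
    obtain ⟨hn, hm, hmono⟩ := hm
    refine ⟨fun t => ?_, fun s t hst => ?_⟩
    · induction t using Fin.lastCases with
      | last => simpa using hn
      | cast t => simpa using ⟨(hm t).1, (hm t).2.trans hn.2⟩
    · induction t using Fin.lastCases with
      | last =>
        induction s using Fin.lastCases with
        | last => rfl
        | cast s => simpa using (hm s).2
      | cast t =>
        induction s using Fin.lastCases with
        | last => exact absurd hst (not_le.2 (Fin.castSucc_lt_last t))
        | cast s => simpa using hmono s t (Fin.castSucc_le_castSucc_iff.1 hst)
  · intro m _
    exact Fin.snoc_init_self m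
  · rintro ⟨n, m⟩ _
    simp
  · intro m _
    rw [Fin.prod_univ_castSucc]
    rfl

theorem harmonicCompleteHomogeneous_zero (i k : ℕ) : harmonicCompleteHomogeneous 0 i k = 1 := by
  simp [harmonicCompleteHomogeneous]

/-- The `q`-th powers of the partial harmonic sum and of its shift by `q` enclose `q! S(k)`. -/
theorem harmonicCompleteHomogeneous_bounds (q i k : ℕ) (hk : i ≤ k) :
    (∑ n ∈ Finset.Icc (i + 1) k, 1 / (n : ℝ)) ^ q ≤
        q.factorial * harmonicCompleteHomogeneous q i k ∧
      q.factorial * harmonicCompleteHomogeneous q i k ≤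
        ((∑ n ∈ Finset.Icc (i + 1) k, 1 / (n : ℝ)) + q) ^ q := by
  induction q generalizing k with
  | zero => simp [harmonicCompleteHomogeneous_zero]
  | succ q ih =>
    induction k, hk using Nat.le_induction with
    | base =>
      simp only [harmonicCompleteHomogeneous_succ, Finset.Icc_eq_empty (Nat.not_succ_le_self i),
        Finset.sum_empty, mul_zero]
      exact ⟨by simp, by positivity⟩
    | succ k hik ihk =>
      obtain ⟨ihl, ihu⟩ := ih (k + 1) (by omega)
      rw [harmonicCompleteHomogeneous_succ] at ihk ⊢
      rw [Finset.sum_Icc_succ_top (by omega)] at ihl ihu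
      simp only [Finset.sum_Icc_succ_top (show i + 1 ≤ k + 1 by omega)]
      set H : ℝ := ∑ n ∈ Finset.Icc (i + 1) k, 1 / (n : ℝ)
      set T : ℝ := ∑ n ∈ Finset.Icc (i + 1) k,
        harmonicCompleteHomogeneous q i n * (1 / (n : ℝ))
      set S : ℝ := harmonicCompleteHomogeneous q i (k + 1)
      set d : ℝ := 1 / ((k + 1 : ℕ) : ℝ) with hd
      have hH0 : 0 ≤ H := Finset.sum_nonneg fun n _ => by positivity
      have hd0 : 0 ≤ d := by positivity
      have hd1 : d ≤ 1 := by
        rw [hd, div_le_one (by positivity)]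
        exact_mod_cast Nat.succ_pos k
      have hfac : ((q + 1).factorial : ℝ) * (T + S * d) =
          (q + 1).factorial * T + (q + 1) * d * (q.factorial * S) := by
        rw [Nat.factorial_succ]
        push_cast
        ring
      have hc : 0 ≤ ((q : ℝ) + 1) * d := by positivity
      obtain ⟨ihkl, ihku⟩ := ihk
      rw [hfac]
      constructor
      · have hpow := abs_pow_sub_pow_le (H + d) H (q + 1)
        rw [add_sub_cancel_left, abs_of_nonneg hd0, abs_of_nonneg hH0,
          abs_of_nonneg (add_nonneg hH0 hd0), max_eq_left (by linarith),
          Nat.add_sub_cancel] at hpow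
        push_cast at hpow
        have := mul_le_mul_of_nonneg_left ihl hc
        linarith [le_abs_self ((H + d) ^ (q + 1) - H ^ (q + 1))]
      · have hbase : H + d + q ≤ H + (q + 1 : ℕ) := by push_cast; linarith
        have hq : (H + d + q) ^ q ≤ (H + (q + 1 : ℕ)) ^ q :=
          pow_le_pow_left₀ (by positivity) hbase q
        have hber : (H + (q + 1 : ℕ)) ^ (q + 1) + (q + 1) * d * (H + (q + 1 : ℕ)) ^ q ≤
            (H + (q + 1 : ℕ) + d) ^ (q + 1) := by
          have := pow_add_mul_le_add_pow (a := H + (q + 1 : ℕ)) (b := d) (by positivity)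
            (by positivity) (q + 1)
          rw [Nat.add_sub_cancel] at this
          push_cast at this ⊢
          linarith
        have := mul_le_mul_of_nonneg_left (ihu.trans hq) hc
        rw [add_right_comm H d]
        linarith

/-- Powers of a bounded perturbation of a function tending to infinity. -/
theorem isBigO_pow_sub_pow_of_isBigO_one {α : Type*} {l : Filter α} {f g : α → ℝ}
    (hg : Tendsto g l atTop) (h : (fun x => f x - g x) =O[l] fun _ => (1 : ℝ)) (q : ℕ) :
    (fun x => f x ^ q - g x ^ q) =O[l] fun x => g x ^ (q - 1) := by
  have h1g : (fun _ : α => (1 : ℝ)) =O[l] g :=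
    (isLittleO_const_left.2 (Or.inr (tendsto_norm_atTop_atTop.comp hg))).isBigO
  have hfg : f =O[l] g := by simpa using (h.trans h1g).add (isBigO_refl g l)
  have hmax : (fun x => max |f x| |g x|) =O[l] g := by
    refine IsBigO.trans (.of_bound 1 (.of_forall fun x => ?_))
      (hfg.norm_left.add (isBigO_refl g l).norm_left :
        (fun x => ‖f x‖ + ‖g x‖) =O[l] g)
    simp only [Real.norm_eq_abs, one_mul]
    rw [abs_of_nonneg (a := max |f x| |g x|) (by positivity),
      abs_of_nonneg (a := |f x| + |g x|) (by positivity)]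
    exact max_le (by linarith [abs_nonneg (g x)]) (by linarith [abs_nonneg (f x)])
  have key : (fun x => f x ^ q - g x ^ q) =O[l]
      fun x => (f x - g x) * max |f x| |g x| ^ (q - 1) := by
    refine .of_bound q (.of_forall fun x => ?_)
    rw [norm_mul, Real.norm_eq_abs, Real.norm_eq_abs, Real.norm_eq_abs,
      abs_of_nonneg (a := max |f x| |g x| ^ (q - 1)) (by positivity)]
    exact (abs_pow_sub_pow_le _ _ _).trans_eq (by ring)
  simpa using key.trans (h.mul (hmax.pow (q - 1)))

/-- A tail of the harmonic sum differs from the logarithm by a bounded amount. -/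
theorem isBigO_sum_Icc_one_div_sub_log (i : ℕ) :
    (fun k : ℕ => (∑ n ∈ Finset.Icc (i + 1) k, 1 / (n : ℝ)) - Real.log k)
      =O[atTop] fun _ => (1 : ℝ) := by
  have h := (Real.tendsto_harmonic_sub_log.sub_const (harmonic i : ℝ)).isBigO_one ℝ
  refine h.congr' ?_ .rfl
  filter_upwards [eventually_ge_atTop i] with k hk
  induction k, hk using Nat.le_induction with
  | base => simp
  | succ k hk ih =>
    rw [Finset.sum_Icc_succ_top (by omega), harmonic_succ]
    push_cast at ih ⊢
    rw [one_div]
    linarith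

/-- Green–Griffiths asymptotic: `S(k) = (log k)^q/q! + O((log k)^{q-1})` as `k → ∞`. -/
theorem harmonicCompleteHomogeneous_asymptotic (q i : ℕ) (hq : 1 ≤ q) :
    (fun k : ℕ =>
        harmonicCompleteHomogeneous q i k - (Real.log k) ^ q / (q.factorial : ℝ))
      =O[atTop] fun k : ℕ => (Real.log k) ^ (q - 1) := by
  have hlog : Tendsto (fun k : ℕ => Real.log k) atTop atTop :=
    Real.tendsto_log_atTop.comp tendsto_natCast_atTop_atTop
  have hH := isBigO_sum_Icc_one_div_sub_log i
  have hlower := isBigO_pow_sub_pow_of_isBigO_one hlog hH q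
  have hupper := isBigO_pow_sub_pow_of_isBigO_one
    (f := fun k : ℕ => (∑ n ∈ Finset.Icc (i + 1) k, 1 / (n : ℝ)) + q) hlog
    ((hH.add (isBigO_const_const (q : ℝ) one_ne_zero atTop)).congr_left fun k => by ring) q
  refine IsBigO.trans (.of_bound 1 ?_) (hlower.norm_left.add hupper.norm_left)
  filter_upwards [eventually_ge_atTop i] with k hk
  obtain ⟨hl, hu⟩ := harmonicCompleteHomogeneous_bounds q i k hk
  set H : ℝ := ∑ n ∈ Finset.Icc (i + 1) k, 1 / (n : ℝ)
  set S : ℝ := harmonicCompleteHomogeneous q i k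
  set L : ℝ := Real.log k
  have hfac : (1 : ℝ) ≤ q.factorial := by exact_mod_cast q.factorial_pos
  have hS : |S - L ^ q / q.factorial| ≤ |q.factorial * S - L ^ q| := by
    rw [show q.factorial * S - L ^ q = q.factorial * (S - L ^ q / q.factorial) by field_simp,
      abs_mul, abs_of_pos (zero_lt_one.trans_le hfac)]
    exact le_mul_of_one_le_left (abs_nonneg _) hfac
  rw [one_mul, Real.norm_eq_abs, Real.norm_eq_abs, Real.norm_eq_abs, Real.norm_eq_abs,
    abs_of_nonneg (a := |H ^ q - L ^ q| + |(H + q) ^ q - L ^ q|) (by positivity)]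
  refine hS.trans (abs_le.2 ⟨?_, ?_⟩)
  · linarith [neg_abs_le (H ^ q - L ^ q), abs_nonneg ((H + q) ^ q - L ^ q)]
  · linarith [le_abs_self ((H + q) ^ q - L ^ q), abs_nonneg (H ^ q - L ^ q)]
end
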